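/- arXiv:2605.16002 — 4 statements merged into one kernel-verified Lean document; each statement's English description precedes it below -/
import Mathlib

section
/- Let G be a real n×n matrix whose symmetric part G_s = (1/2)(G + Gᵀ) is positive definite, let Ā ∈ ℝ^{k×n}, a_p ∈ ℝⁿ, r̄ ∈ ℝᵏ, and let z ∈ ℝⁿ satisfy Ā z = 0 and G z = Āᵀ r̄ − a_p. If z ≠ 0, then a_pᵀ z < 0. -/
open Matrix

/-- A real quadratic form depends only on the symmetric part of its matrix. -/
theorem dotProduct_symmPart_mulVec {ι : Type*} [Fintype ι] (G : Matrix ι ι ℝ) (x : ι → ℝ) :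
    x ⬝ᵥ (((1/2 : ℝ) • (G + Gᵀ)) *ᵥ x) = x ⬝ᵥ (G *ᵥ x) := by
  have htr : x ⬝ᵥ (Gᵀ *ᵥ x) = x ⬝ᵥ (G *ᵥ x) := by
    rw [mulVec_transpose, dotProduct_comm, ← dotProduct_mulVec]
  rw [smul_mulVec, add_mulVec, dotProduct_smul, dotProduct_add, htr, smul_eq_mul]
  ring

/-- Lemma 3, (ii) ⇒ (iii): if `z ≠ 0` then `a_pᵀ z < 0`. -/
theorem goldnash_descent_of_ne_zero {n k : ℕ} (G : Matrix (Fin n) (Fin n) ℝ)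
    (Abar : Matrix (Fin k) (Fin n) ℝ) (ap : Fin n → ℝ) (rbar : Fin k → ℝ)
    (z : Fin n → ℝ)
    (hG : ∀ x : Fin n → ℝ, x ≠ 0 → 0 < x ⬝ᵥ (((1/2 : ℝ) • (G + Gᵀ)) *ᵥ x))
    (hz : Abar *ᵥ z = 0)
    (hstep : G *ᵥ z = Abarᵀ *ᵥ rbar - ap)
    (hzne : z ≠ 0) :
    ap ⬝ᵥ z < 0 := by
  have hpos := hG z hzne
  have horth : z ⬝ᵥ (Abarᵀ *ᵥ rbar) = 0 := by
    rw [dotProduct_mulVec, vecMul_transpose, hz, zero_dotProduct]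
  rw [dotProduct_symmPart_mulVec, hstep, dotProduct_sub, horth, dotProduct_comm z ap] at hpos
  linarith
end

section
/- Let G be a real n×n matrix whose symmetric part G_s = (1/2)(G + Gᵀ) is positive definite, let Ā ∈ ℝ^{k×n}, a_p ∈ ℝⁿ, r̄ ∈ ℝᵏ, and let z ∈ ℝⁿ satisfy Ā z = 0 and G z = Āᵀ r̄ − a_p. If z ≠ 0, then a_p is not in the row span of Ā (i.e., a_p ≠ Āᵀ v for every v ∈ ℝᵏ). -/
open Matrix

/-- Lemma 3, (ii) ⇒ (i): if `z ≠ 0`, then `a_p` is not in the row span of `Ā`. -/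
theorem goldnash_not_rowspan_of_ne_zero {n k : ℕ} (G : Matrix (Fin n) (Fin n) ℝ)
    (Abar : Matrix (Fin k) (Fin n) ℝ) (ap : Fin n → ℝ) (rbar : Fin k → ℝ)
    (z : Fin n → ℝ)
    (hG : ∀ x : Fin n → ℝ, x ≠ 0 → 0 < x ⬝ᵥ (((1/2 : ℝ) • (G + Gᵀ)) *ᵥ x))
    (hz : Abar *ᵥ z = 0)
    (hstep : G *ᵥ z = Abarᵀ *ᵥ rbar - ap)
    (hzne : z ≠ 0) :
    ∀ v : Fin k → ℝ, ap ≠ Abarᵀ *ᵥ v := by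
  rintro v rfl
  have hzero : z ⬝ᵥ (G *ᵥ z) = 0 := by
    rw [hstep, ← mulVec_sub, dotProduct_mulVec, vecMul_transpose, hz, zero_dotProduct]
  have htrans : z ⬝ᵥ (Gᵀ *ᵥ z) = 0 := by
    rw [dotProduct_mulVec, vecMul_transpose, dotProduct_comm, hzero]
  have hpos := hG z hzne
  rw [smul_mulVec, add_mulVec, dotProduct_smul, dotProduct_add, hzero, htrans] at hpos
  simp at hpos
end

section
/- Let G be a real n×n matrix whose symmetric part G_s = (1/2)(G + Gᵀ) is positive definite, let Ā ∈ ℝ^{k×n} have full row rank, let a_p ∈ ℝⁿ with a_p ≠ 0, let r̄ ∈ ℝᵏ, and let z ∈ ℝⁿ satisfy Ā z = 0 and G z = Āᵀ r̄ − a_p. Then the following three statements are equivalent: (i) a_p is not in the row span of Ā; (ii) z ≠ 0; (iii) a_pᵀ z < 0. -/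
open Matrix

/-- A vector in the kernel of a matrix is orthogonal to its row span. -/
theorem transpose_mulVec_dotProduct_eq_zero {ι κ : Type*} [Fintype ι] [Fintype κ]
    {A : Matrix κ ι ℝ} {z : ι → ℝ} (hz : A *ᵥ z = 0) (v : κ → ℝ) :
    (Aᵀ *ᵥ v) ⬝ᵥ z = 0 := by
  rw [mulVec_transpose, ← dotProduct_mulVec, hz, dotProduct_zero]

/-- Lemma 3 (full statement): under strong monotonicity and full row rank of `Ā`,
with `a_p ≠ 0`, the three conditions (i) `a_p ∉ rowspan(Ā)`, (ii) `z ≠ 0`, and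
(iii) `a_pᵀ z < 0` are equivalent. -/
theorem goldnash_descent_tfae {n k : ℕ} (G : Matrix (Fin n) (Fin n) ℝ)
    (Abar : Matrix (Fin k) (Fin n) ℝ) (ap : Fin n → ℝ) (rbar : Fin k → ℝ)
    (z : Fin n → ℝ)
    (hG : ∀ x : Fin n → ℝ, x ≠ 0 → 0 < x ⬝ᵥ (((1/2 : ℝ) • (G + Gᵀ)) *ᵥ x))
    (hA : ∀ v : Fin k → ℝ, Abarᵀ *ᵥ v = 0 → v = 0)
    (hap : ap ≠ 0)
    (hz : Abar *ᵥ z = 0)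
    (hstep : G *ᵥ z = Abarᵀ *ᵥ rbar - ap) :
    ((∀ v : Fin k → ℝ, ap ≠ Abarᵀ *ᵥ v) ↔ z ≠ 0) ∧
      (z ≠ 0 ↔ ap ⬝ᵥ z < 0) := by
  have neg_of_ne : z ≠ 0 → ap ⬝ᵥ z < 0 := by
    intro h
    have hpos := hG z h
    rw [dotProduct_symmPart_mulVec, hstep, dotProduct_comm, sub_dotProduct,
      transpose_mulVec_dotProduct_eq_zero hz] at hpos
    linarith
  refine ⟨⟨?_, ?_⟩, neg_of_ne, ?_⟩
  · rintro h rfl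
    rw [mulVec_zero] at hstep
    exact h rbar (sub_eq_zero.mp hstep.symm).symm
  · intro h v hv
    have hneg := neg_of_ne h
    rw [hv, transpose_mulVec_dotProduct_eq_zero hz] at hneg
    exact hneg.false
  · rintro h rfl
    simp at h
end

section
/- Let G be a real n×n matrix whose symmetric part G_s = (1/2)(G + Gᵀ) is positive definite, let Ā ∈ ℝ^{k×n} have full row rank, let a_p ∈ ℝⁿ, r̄ ∈ ℝᵏ, and let z ∈ ℝⁿ satisfy Ā z = 0 and G z = Āᵀ r̄ − a_p. If a_pᵀ z < 0, then the (k+1)×n matrix obtained by appending the row a_pᵀ to Ā has full row rank k+1. -/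
open Matrix

/-- Appending the row `a` to `A` adds the multiple of `a` by the last coefficient to the
combination of the rows of `A`. -/
theorem transpose_of_snoc_mulVec {n k : ℕ} (A : Matrix (Fin k) (Fin n) ℝ) (a : Fin n → ℝ)
    (v : Fin (k + 1) → ℝ) :
    (Matrix.of (Fin.snoc (fun i => A i) a) : Matrix (Fin (k + 1)) (Fin n) ℝ)ᵀ *ᵥ v =
      Aᵀ *ᵥ (fun i => v i.castSucc) + v (Fin.last k) • a := by
  ext j
  simp [Matrix.mulVec, dotProduct, Fin.sum_univ_castSucc, mul_comm]

/-- Full-row-rank preservation when adding a constraint in the GoldNash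
algorithm: if `Ā` has full row rank, `Ā z = 0`, `G z = Āᵀ r̄ − a_p` and
`a_pᵀ z < 0`, then appending the row `a_pᵀ` to `Ā` yields a matrix of full row
rank `k + 1`. -/
theorem goldnash_add_row_full_rank {n k : ℕ} (G : Matrix (Fin n) (Fin n) ℝ)
    (Abar : Matrix (Fin k) (Fin n) ℝ) (ap : Fin n → ℝ) (rbar : Fin k → ℝ)
    (z : Fin n → ℝ)
    (hG : ∀ x : Fin n → ℝ, x ≠ 0 → 0 < x ⬝ᵥ (((1/2 : ℝ) • (G + Gᵀ)) *ᵥ x))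
    (hA : ∀ v : Fin k → ℝ, Abarᵀ *ᵥ v = 0 → v = 0)
    (hz : Abar *ᵥ z = 0)
    (hstep : G *ᵥ z = Abarᵀ *ᵥ rbar - ap)
    (hdesc : ap ⬝ᵥ z < 0) :
    ∀ v : Fin (k + 1) → ℝ,
      (Matrix.of (Fin.snoc (fun i => Abar i) ap) :
        Matrix (Fin (k + 1)) (Fin n) ℝ)ᵀ *ᵥ v = 0 → v = 0 := by
  intro v hv
  rw [transpose_of_snoc_mulVec] at hv
  have hlast : v (Fin.last k) = 0 := by
    have h := congrArg (· ⬝ᵥ z) hv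
    simp only [add_dotProduct, smul_dotProduct, mulVec_transpose, ← dotProduct_mulVec, hz,
      dotProduct_zero, zero_dotProduct, zero_add, smul_eq_mul] at h
    exact (mul_eq_zero.mp h).resolve_right hdesc.ne
  have hinit := hA (fun i => v i.castSucc) (by simpa [hlast] using hv)
  ext i
  induction i using Fin.lastCases with
  | last => exact hlast
  | cast i => exact congrFun hinit i
end
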